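/- The set of integer group determinants of GA(1,27) is exactly the set of integers of the form A·B^26 where A and B are integers with B ≡ A (mod 27), and A satisfies: if 2 divides A then 4 divides A, and if 13 divides A then 13^2 divides A. -/

import Mathlib

/-- The group determinant of a family of integers indexed by a finite group `G`:
`det (a (g * h⁻¹))`. -/
noncomputable def groupDet (G : Type*) [Group G] [Finite G] (a : G → ℤ) : ℤ :=
  letI : Fintype G := Fintype.ofFinite G
  letI : DecidableEq G := Classical.decEq G
  Matrix.det (Matrix.of fun g h : G => a (g * h⁻¹))

/-- `D` is an integer group determinant of the finite group `G`. -/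
def IsIntGroupDet (G : Type*) [Group G] [Finite G] (D : ℤ) : Prop :=
  ∃ a : G → ℤ, groupDet G a = D

/-- `D` is a `ℤ_m` integer group determinant: a determinant of an integer circulant
matrix `(a_{(i-j) mod m})`. -/
def IsCirculantDet (m : ℕ) (D : ℤ) : Prop :=
  ∃ a : Fin m → ℤ, (Matrix.circulant a).det = D

/-- The action of `F_q^×` on the additive group of `F_q` by multiplication, as a
homomorphism to the automorphism group of `Multiplicative F_q`. -/
noncomputable def GAaction (p k : ℕ) [Fact p.Prime] :
    (GaloisField p k)ˣ →* MulAut (Multiplicative (GaloisField p k)) where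
  toFun u :=
    { toFun := fun x => Multiplicative.ofAdd (u • x.toAdd)
      invFun := fun x => Multiplicative.ofAdd (u⁻¹ • x.toAdd)
      left_inv := fun x => by simp
      right_inv := fun x => by simp
      map_mul' := fun x y => by
        simp [toAdd_mul, smul_add, ofAdd_add] }
  map_one' := by
    ext x
    simp
  map_mul' u v := by
    ext x
    simp [mul_smul]

instance {N G : Type*} [Group N] [Group G] {φ : G →* MulAut N} [Finite N] [Finite G] :
    Finite (N ⋊[φ] G) :=
  Finite.of_equiv (N × G)
    ⟨fun x => ⟨x.1, x.2⟩, fun x => (x.left, x.right), fun _ => rfl, fun _ => rfl⟩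

/-- `GA(1,q)` for `q = p^k`: the semidirect product `F_q ⋊ F_q^×`. -/
abbrev GA1 (p k : ℕ) [Fact p.Prime] :=
  Multiplicative (GaloisField p k) ⋊[GAaction p k] (GaloisField p k)ˣ

section LiftDet

variable {n : Type*} [Fintype n] [DecidableEq n]

/-- The submonoid of those matrices over `ZMod N` that lift to integer matrices of
determinant one. -/
def liftableMatrices (n : Type*) [Fintype n] [DecidableEq n] (N : ℕ) :
    Submonoid (Matrix n n (ZMod N)) where
  carrier := {X | ∃ Y : Matrix n n ℤ, Y.det = 1 ∧ Y.map (Int.castRingHom (ZMod N)) = X}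
  one_mem' := ⟨1, by simp, by simp⟩
  mul_mem' := by
    rintro _ _ ⟨Y, hY, rfl⟩ ⟨Z, hZ, rfl⟩
    exact ⟨Y * Z, by simp [hY, hZ], by rw [Matrix.map_mul]⟩

theorem transvection_mem_liftableMatrices {N : ℕ} {i j : n} (hij : i ≠ j) (c : ZMod N) :
    Matrix.transvection i j c ∈ liftableMatrices n N := by
  obtain ⟨c, rfl⟩ := ZMod.intCast_surjective c
  refine ⟨Matrix.transvection i j c, Matrix.det_transvection_of_ne i j hij c, ?_⟩
  ext a b
  by_cases h : i = a ∧ j = b <;> by_cases hab : a = b <;>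
    simp [Matrix.transvection, Matrix.single_apply, h, hab]

theorem diagonal_mulSingle_mem_liftableMatrices {N : ℕ} {i j : n} (hij : i ≠ j)
    (u : (ZMod N)ˣ) :
    Matrix.diagonal (fun k => ((Pi.mulSingle i u * Pi.mulSingle j u⁻¹ : n → (ZMod N)ˣ) k : ZMod N))
      ∈ liftableMatrices n N := by
  have key : Matrix.diagonal
      (fun k => ((Pi.mulSingle i u * Pi.mulSingle j u⁻¹ : n → (ZMod N)ˣ) k : ZMod N)) =
      Matrix.transvection i j (u : ZMod N) * Matrix.transvection j i (-(u⁻¹ : (ZMod N)ˣ) : ZMod N) *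
        Matrix.transvection i j (u : ZMod N) *
        (Matrix.transvection i j (-1) * Matrix.transvection j i 1 *
          Matrix.transvection i j (-1)) := by
    simp only [Matrix.transvection, mul_add, add_mul, mul_one, one_mul, Matrix.single_mul_single_same,
      Matrix.single_mul_single_of_ne _ _ _ _ hij, Matrix.single_mul_single_of_ne _ _ _ _ hij.symm]
    ext a b
    by_cases hab : a = b
    · subst hab
      by_cases ha : a = i
      · subst ha
        simp [hij, hij.symm]
      · by_cases ha' : a = j
        · subst ha'
          simp [hij, hij.symm]
        · simp [ha, ha', Ne.symm ha, Ne.symm ha']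
    · by_cases h1 : i = a ∧ j = b
      · obtain ⟨rfl, rfl⟩ := h1
        simp [hij, hij.symm]
      · by_cases h2 : j = a ∧ i = b
        · obtain ⟨rfl, rfl⟩ := h2
          simp [hij, hij.symm]
        · have h3 : ¬ (i = a ∧ i = b) := by rintro ⟨rfl, rfl⟩; exact hab rfl
          have h4 : ¬ (j = a ∧ j = b) := by rintro ⟨rfl, rfl⟩; exact hab rfl
          simp [hab, h1, h2, h3, h4]
  rw [key]
  have h1 := fun c : ZMod N => transvection_mem_liftableMatrices hij c
  have h2 := fun c : ZMod N => transvection_mem_liftableMatrices hij.symm c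
  exact mul_mem (mul_mem (mul_mem (h1 _) (h2 _)) (h1 _))
    (mul_mem (mul_mem (h1 _) (h2 _)) (h1 _))

theorem diagonal_mem_liftableMatrices {N : ℕ} (a : n → (ZMod N)ˣ) (ha : ∏ i, a i = 1) :
    Matrix.diagonal (fun k => (a k : ZMod N)) ∈ liftableMatrices n N := by
  let D : (n → (ZMod N)ˣ) →* Matrix n n (ZMod N) :=
    { toFun := fun a => Matrix.diagonal fun k => (a k : ZMod N)
      map_one' := by simp
      map_mul' := fun a b => by simp }
  change a ∈ (liftableMatrices n N).comap D
  rcases isEmpty_or_nonempty n with hn | ⟨⟨j⟩⟩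
  · rw [Subsingleton.elim a 1]
    exact one_mem _
  have hprod : ∏ i, (Pi.mulSingle i (a i) * Pi.mulSingle j (a i)⁻¹ : n → (ZMod N)ˣ) = a := by
    rw [Finset.prod_mul_distrib, Finset.univ_prod_mulSingle]
    have : ∏ i, (Pi.mulSingle j (a i)⁻¹ : n → (ZMod N)ˣ) = 1 := by
      have h := map_prod (MonoidHom.mulSingle (fun _ : n => (ZMod N)ˣ) j)
        (fun i => (a i)⁻¹) Finset.univ
      simp only [MonoidHom.mulSingle_apply] at h
      rw [← h, Finset.prod_inv_distrib, ha, inv_one, Pi.mulSingle_one]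
    rw [this, mul_one]
  rw [← hprod]
  refine prod_mem fun i _ => ?_
  by_cases hij : i = j
  · subst hij
    rw [← Pi.mulSingle_mul, mul_inv_cancel, Pi.mulSingle_one]
    exact one_mem _
  · exact diagonal_mulSingle_mem_liftableMatrices hij (a i)

/-- Smith decomposition of a nonsingular square matrix over a principal ideal domain. -/
theorem Matrix.exists_eq_mul_diagonal_mul {R : Type*} [CommRing R] [IsDomain R]
    [IsPrincipalIdealRing R] (X : Matrix n n R) (hX : X.det ≠ 0) :
    ∃ (P Q : Matrix n n R) (a : n → R), IsUnit P.det ∧ IsUnit Q.det ∧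
      X = P * Matrix.diagonal a * Q := by
  let f : (n → R) →ₗ[R] (n → R) := Matrix.toLin' X
  have hf : Function.Injective f := by
    refine (injective_iff_map_eq_zero f).2 fun v hv => ?_
    by_contra hv0
    exact hX (Matrix.exists_mulVec_eq_zero_iff.1 ⟨v, hv0, hv⟩)
  let e := LinearEquiv.ofInjective f hf
  obtain ⟨b', a, ab', h⟩ := Submodule.exists_smith_normal_form_of_rank_eq
    (Pi.basisFun R n) (N := LinearMap.range f) e.finrank_eq.symm
  let b₀ := Pi.basisFun R n
  let c := ab'.map e.symm
  have hdet : ∀ b₁ b₂ : Module.Basis n R (n → R), IsUnit (b₁.toMatrix b₂).det := fun b₁ b₂ => by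
    have := b₁.invertibleToMatrix b₂
    exact (Matrix.isUnit_iff_isUnit_det _).1 (isUnit_of_invertible _)
  refine ⟨b₀.toMatrix b', c.toMatrix b₀, a, hdet _ _, hdet _ _, ?_⟩
  have hdiag : LinearMap.toMatrix c b' f = Matrix.diagonal a := by
    ext i j
    have hfc : f (c j) = a j • b' j := by
      rw [← h j]
      have := LinearEquiv.ofInjective_apply f (h := hf) (c j)
      rw [← this]
      simp [c, e]
    rw [LinearMap.toMatrix_apply, hfc]
    by_cases hij : i = j
    · subst hij; simp
    · simp [hij]
  rw [← hdiag, basis_toMatrix_mul_linearMap_toMatrix_mul_basis_toMatrix]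
  exact (LinearMap.toMatrix'_toLin' X).symm

/-- An integer matrix whose determinant is one modulo `N` is congruent modulo `N` to an integer
matrix of determinant one. -/
theorem Matrix.exists_det_eq_one_of_modEq {N : ℕ} (X : Matrix n n ℤ) (hX0 : X.det ≠ 0)
    (hX : (X.det : ZMod N) = 1) :
    ∃ Y : Matrix n n ℤ, Y.det = 1 ∧ ∀ i j, (Y i j : ZMod N) = X i j := by
  obtain ⟨P, Q, a, hP, hQ, rfl⟩ := X.exists_eq_mul_diagonal_mul hX0
  rcases isEmpty_or_nonempty n with hn | ⟨⟨j⟩⟩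
  · exact ⟨1, by simp, fun i => isEmptyElim i⟩
  have hs : ∃ s : ℤˣ, P.det * Q.det = s := ⟨(hP.mul hQ).unit, rfl⟩
  obtain ⟨s, hs⟩ := hs
  have hdet : ((∏ i, a i : ℤ) : ZMod N) * ((s : ℤ) : ZMod N) = 1 := by
    rw [← hX, ← Int.cast_mul, ← hs, Matrix.det_mul, Matrix.det_mul, Matrix.det_diagonal]
    congr 1
    ring
  have hunit : ∀ i, IsUnit ((a i : ℤ) : ZMod N) := fun i => by
    have h1 : IsUnit ((∏ i, a i : ℤ) : ZMod N) := IsUnit.of_mul_eq_one _ hdet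
    rw [Int.cast_prod] at h1
    exact isUnit_of_dvd_unit (Finset.dvd_prod_of_mem (fun i => (a i : ZMod N)) (Finset.mem_univ i)) h1
  let t : (ZMod N)ˣ := Units.map (Int.castRingHom (ZMod N)).toMonoidHom s
  let u : n → (ZMod N)ˣ := fun i => (hunit i).unit
  obtain ⟨D, hD, hDmap⟩ := diagonal_mem_liftableMatrices (u * Pi.mulSingle j t) (by
    rw [Units.ext_iff]
    simp only [Pi.mul_apply, Finset.prod_mul_distrib, Finset.prod_pi_mulSingle', Units.val_mul,
      Units.val_one, Finset.mem_univ, if_true]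
    rw [← hdet]
    simp [u, t])
  have hss : ((s : ℤ)) * s = 1 := by
    rw [← Units.val_mul, ← sq, Int.units_sq]; rfl
  have hS : (Matrix.diagonal (Pi.mulSingle j (s : ℤ))).det = s := by
    rw [Matrix.det_diagonal, Finset.prod_pi_mulSingle', if_pos (Finset.mem_univ j)]
  refine ⟨P * (Matrix.diagonal (Pi.mulSingle j (s : ℤ)) * D) * Q, ?_, ?_⟩
  · rw [Matrix.det_mul, Matrix.det_mul, Matrix.det_mul, hS, hD, mul_one]
    linear_combination (s : ℤ) * hs + hss
  · have hcomp : (Matrix.diagonal (Pi.mulSingle j (s : ℤ)) * D).map (Int.castRingHom (ZMod N)) =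
        (Matrix.diagonal a).map (Int.castRingHom (ZMod N)) := by
      rw [Matrix.map_mul, hDmap, Matrix.diagonal_map (by simp), Matrix.diagonal_map (by simp),
        Matrix.diagonal_mul_diagonal]
      congr 1
      funext i
      by_cases hij : i = j
      · subst hij
        have : (((s : ℤ)) * s : ZMod N) = 1 := by exact_mod_cast congrArg (Int.cast (R := ZMod N)) hss
        simp only [Pi.mulSingle_eq_same, Pi.mul_apply, Units.val_mul]
        simp only [u, t]
        simp
        linear_combination (a i : ZMod N) * this
      · simp [hij, u]
    have h2 : (P * (Matrix.diagonal (Pi.mulSingle j (s : ℤ)) * D) * Q).map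
        (Int.castRingHom (ZMod N)) =
        (P * Matrix.diagonal a * Q).map (Int.castRingHom (ZMod N)) := by
      rw [Matrix.map_mul, Matrix.map_mul, hcomp, ← Matrix.map_mul, ← Matrix.map_mul]
    intro i k
    exact congrFun (congrFun h2 i) k

/-- If `X` has determinant one modulo `N`, then adding a constant `l` to all its entries gives a
matrix that has lifts modulo `N` of any determinant in the right class. -/
theorem Matrix.exists_det_eq_of_modEq_add_const [Nonempty n] {N : ℕ} (X : Matrix n n ℤ)
    (hX0 : X.det ≠ 0) (hX : (X.det : ZMod N) = 1) (l B : ℤ)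
    (hB : B ≡ (X + Matrix.of fun _ _ => l).det [ZMOD N]) :
    ∃ Y : Matrix n n ℤ, (X + Matrix.of (fun _ _ => l) + (N : ℤ) • Y).det = B := by
  obtain ⟨X₁, h1, hXX⟩ := X.exists_det_eq_one_of_modEq hX0 hX
  have j : n := Classical.arbitrary n
  let z : n → ℤ := X₁.adjugate.mulVec fun _ => 1
  have hz : X₁.mulVec z = fun _ => 1 := by
    simp [z, Matrix.mulVec_mulVec, Matrix.mul_adjugate, h1]
  let w : ℤ → n → ℤ := fun k => l • z + Pi.single j (N * k)
  let Z : ℤ → Matrix n n ℤ := fun k => X₁ * (1 + Matrix.vecMulVec (w k) fun _ => 1)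
  have hZdet : ∀ k, (Z k).det = 1 + l * ∑ i, z i + N * k := fun k => by
    have : (1 + Matrix.vecMulVec (w k) fun _ => (1 : ℤ)).det = 1 + (fun _ => 1) ⬝ᵥ w k := by
      rw [Matrix.vecMulVec_eq Unit, Matrix.det_one_add_replicateCol_mul_replicateRow]
    simp only [Z]
    rw [Matrix.det_mul, h1, one_mul, this]
    simp [w, dotProduct, Finset.sum_add_distrib, Finset.mul_sum, add_assoc]
  have hZ : ∀ k i m, Z k i m = X₁ i m + l + N * (k * X₁ i j) := fun k i m => by
    have h2 : Z k = X₁ + Matrix.vecMulVec (X₁.mulVec (w k)) fun _ => 1 := by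
      simp only [Z]
      rw [mul_add, mul_one, Matrix.mul_vecMulVec]
    rw [h2]
    simp only [w, Matrix.mulVec_add, Matrix.mulVec_smul, hz]
    simp [Matrix.vecMulVec_apply]
    ring
  have hcast : ∀ k, ((Z k).map (Int.castRingHom (ZMod N))) =
      (X + Matrix.of fun _ _ => l).map (Int.castRingHom (ZMod N)) := fun k => by
    ext i m
    simp [hZ, hXX]
  have hdetcast : ((Z 0).det : ZMod N) = ((X + Matrix.of fun _ _ => l).det : ℤ) := by
    have h3 := congrArg Matrix.det (hcast 0)
    rwa [← RingHom.mapMatrix_apply, ← RingHom.mapMatrix_apply, ← RingHom.map_det,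
      ← RingHom.map_det] at h3
  obtain ⟨k, hk⟩ : (N : ℤ) ∣ B - (Z 0).det := by
    rw [← ZMod.intCast_eq_intCast_iff_dvd_sub, hdetcast]
    exact ((ZMod.intCast_eq_intCast_iff _ _ _).2 hB).symm
  have hdvd : ∀ i m, (N : ℤ) ∣ Z k i m - (X + Matrix.of fun _ _ => l : Matrix n n ℤ) i m :=
    fun i m => by
      rw [← ZMod.intCast_eq_intCast_iff_dvd_sub]
      exact (congrFun (congrFun (hcast k) i) m).symm
  choose Y hY using hdvd
  refine ⟨Matrix.of Y, ?_⟩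
  have hZY : X + Matrix.of (fun _ _ => l) + (N : ℤ) • Matrix.of Y = Z k := by
    ext i m
    have := hY i m
    simp only [Matrix.add_apply, Matrix.smul_apply, Matrix.of_apply, smul_eq_mul] at this ⊢
    linarith
  rw [hZY]
  have h0 := hZdet 0
  rw [hZdet k]
  linarith

end LiftDet

section AffineDet

variable {F : Type*} [Field F] [Fintype F]

/-- The group matrix of `F ⋊ Fˣ`, indexed by pairs (scaling, translation). -/
def affineMatrix (a : F → Fˣ → ℤ) : Matrix (Fˣ × F) (Fˣ × F) ℤ :=
  Matrix.of fun g h => a (g.2 - (g.1 * h.1⁻¹ : Fˣ) * h.2) (g.1 * h.1⁻¹)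

/-- The group matrix of the image of `a` in the group ring of `Fˣ`. -/
def scalingMatrix (a : F → Fˣ → ℤ) : Matrix Fˣ Fˣ ℤ :=
  Matrix.of fun u v => ∑ b, a b (u * v⁻¹)

/-- The matrix of `a` in the representation of `F ⋊ Fˣ` induced from the additive character
`x ↦ ψ (r * x)`. -/
noncomputable def inducedMatrix (ψ : AddChar F ℂ) (a : F → Fˣ → ℤ) (r : F) : Matrix Fˣ Fˣ ℂ :=
  Matrix.of fun u v => ∑ b, ψ (r * (u⁻¹ : Fˣ) * b) * a b (u * v⁻¹)

theorem inducedMatrix_zero (ψ : AddChar F ℂ) (a : F → Fˣ → ℤ) :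
    inducedMatrix ψ a 0 = (scalingMatrix a).map (Int.castRingHom ℂ) := by
  ext u v
  simp [inducedMatrix, scalingMatrix]

variable [DecidableEq F]

/-- The action of `a` on the augmentation ideal of the group ring of `F`, in the basis
`[x] - [0]` for `x ≠ 0`. -/
def augmentationMatrix (a : F → Fˣ → ℤ) : Matrix Fˣ Fˣ ℤ :=
  Matrix.of fun x y => ∑ u : Fˣ, (a (x - u * y) u - a x u)

theorem AddChar.IsPrimitive.sum_mul {ψ : AddChar F ℂ} (hψ : ψ.IsPrimitive) (r : F) :
    ∑ x, ψ (r * x) = if r = 0 then (Fintype.card F : ℂ) else 0 := by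
  have := AddChar.sum_mulShift r hψ
  simp only [mul_comm _ r] at this
  rw [this]
  split_ifs <;> simp

theorem det_inducedMatrix_of_ne_zero (ψ : AddChar F ℂ) (a : F → Fˣ → ℤ) (r : Fˣ) :
    (inducedMatrix ψ a r).det = (inducedMatrix ψ a 1).det := by
  have : inducedMatrix ψ a r =
      (inducedMatrix ψ a 1).submatrix (Equiv.mulLeft r⁻¹) (Equiv.mulLeft r⁻¹) := by
    ext u v
    have h : r⁻¹ * u * (r⁻¹ * v)⁻¹ = u * v⁻¹ := by
      rw [mul_inv_rev, inv_inv]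
      rw [mul_comm v⁻¹ r, mul_mul_mul_comm, inv_mul_cancel, one_mul]
    have h' : (r⁻¹ * u)⁻¹ = r * u⁻¹ := by rw [mul_inv_rev, inv_inv, mul_comm]
    simp only [inducedMatrix, Matrix.submatrix_apply, Matrix.of_apply, Equiv.coe_mulLeft, h, h',
      Units.val_mul, one_mul]
  rw [this, Matrix.det_submatrix_equiv_self]

theorem det_affineMatrix_eq_prod {ψ : AddChar F ℂ} (hψ : ψ.IsPrimitive) (a : F → Fˣ → ℤ) :
    ((affineMatrix a).det : ℂ) = ∏ r, (inducedMatrix ψ a r).det := by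
  let T : Matrix (Fˣ × F) (Fˣ × F) ℂ :=
    Matrix.of fun g h => if g.1 = h.1 then ψ (g.2 * (g.1⁻¹ : Fˣ) * h.2) else 0
  let T' : Matrix (Fˣ × F) (Fˣ × F) ℂ :=
    Matrix.of fun g h => if g.1 = h.1 then ψ (-(h.2 * (g.1⁻¹ : Fˣ) * g.2)) else 0
  have hTT' : T * T' = (Fintype.card F : ℂ) • 1 := by
    ext ⟨u, r⟩ ⟨w, s⟩
    simp only [T, T', Matrix.mul_apply, Matrix.of_apply, Fintype.sum_prod_type, ite_mul, zero_mul,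
      mul_ite, mul_zero, Matrix.smul_apply, Matrix.one_apply, Prod.mk.injEq, smul_eq_mul, mul_one]
    rw [Finset.sum_eq_single w (fun x _ hx => by simp [hx]) (by simp)]
    simp only [if_true]
    by_cases huw : u = w
    · subst huw
      simp only [if_true, true_and, ← AddChar.map_add_eq_mul]
      have := hψ.sum_mul ((r - s) * (u⁻¹ : Fˣ))
      simp only [mul_eq_zero, Units.ne_zero, or_false, sub_eq_zero] at this
      rw [← this]
      refine Finset.sum_congr rfl fun b _ => ?_
      congr 1
      ring
    · simp [huw]
  have hT : T.det ≠ 0 := by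
    intro h
    have := congrArg Matrix.det hTT'
    rw [Matrix.det_mul, h, zero_mul, Matrix.det_smul, Matrix.det_one, mul_one] at this
    exact pow_ne_zero _ (Nat.cast_ne_zero.2 Fintype.card_ne_zero) this.symm
  have hconj : T * (affineMatrix a).map (Int.castRingHom ℂ) =
      Matrix.blockDiagonal (inducedMatrix ψ a) * T := by
    ext ⟨u, r⟩ ⟨v, c⟩
    simp only [T, Matrix.mul_apply, Matrix.of_apply, Fintype.sum_prod_type, ite_mul, zero_mul,
      mul_ite, mul_zero, Matrix.map_apply, affineMatrix, Matrix.blockDiagonal_apply]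
    rw [Finset.sum_comm]
    simp only [Finset.sum_ite_eq, Finset.mem_univ, if_true]
    rw [Finset.sum_eq_single v (fun x _ hx => by simp [hx]) (by simp)]
    simp only [if_true]
    simp only [Finset.sum_ite_eq, Finset.mem_univ, if_true, inducedMatrix, Matrix.of_apply,
      Finset.sum_mul]
    rw [← Equiv.sum_comp (Equiv.addRight ((u * v⁻¹ : Fˣ) * c : F))]
    refine Finset.sum_congr rfl fun b _ => ?_
    simp only [Equiv.coe_addRight, add_sub_cancel_right]
    have h : r * (u⁻¹ : Fˣ) * (b + (u * v⁻¹ : Fˣ) * c) =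
        r * (u⁻¹ : Fˣ) * b + r * (v⁻¹ : Fˣ) * c := by
      have : ((u⁻¹ : Fˣ) : F) * u = 1 := Units.inv_mul u
      rw [Units.val_mul]
      linear_combination r * (v⁻¹ : Fˣ) * c * this
    rw [h, AddChar.map_add_eq_mul]
    simp only [eq_intCast]
    ring
  have hdet := congrArg Matrix.det hconj
  rw [Matrix.det_mul, Matrix.det_mul, Matrix.det_blockDiagonal, mul_comm,
    ← RingHom.mapMatrix_apply, ← RingHom.map_det] at hdet
  exact mul_right_cancel₀ hT hdet

theorem sum_units_eq_sub {M : Type*} [AddCommGroup M] (f : F → M) :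
    ∑ x : Fˣ, f x = ∑ x, f x - f 0 := by
  rw [← Finset.add_sum_erase _ f (Finset.mem_univ 0), add_sub_cancel_left]
  refine Finset.sum_bij (fun x _ => (x : F)) ?_ ?_ ?_ ?_
  · simp
  · simp [Units.ext_iff]
  · intro b hb
    exact ⟨Units.mk0 b (Finset.ne_of_mem_erase hb), by simp⟩
  · simp

theorem det_inducedMatrix_one {ψ : AddChar F ℂ} (hψ : ψ.IsPrimitive) (a : F → Fˣ → ℤ) :
    (inducedMatrix ψ a 1).det = ((augmentationMatrix a).det : ℂ) := by
  let T : Matrix Fˣ Fˣ ℂ := Matrix.of fun u y => ψ ((u⁻¹ : Fˣ) * y) - 1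
  let T' : Matrix Fˣ Fˣ ℂ := Matrix.of fun y v => ψ (-((v⁻¹ : Fˣ) * y))
  have hTT' : T * T' = (Fintype.card F : ℂ) • 1 := by
    ext u v
    simp only [T, T', Matrix.mul_apply, Matrix.of_apply, Matrix.smul_apply, Matrix.one_apply,
      smul_eq_mul]
    rw [sum_units_eq_sub (fun y : F => (ψ ((u⁻¹ : Fˣ) * y) - 1) * ψ (-((v⁻¹ : Fˣ) * y)))]
    simp only [mul_zero, AddChar.map_zero_eq_one, sub_self, zero_mul, sub_zero, sub_mul, one_mul,
      Finset.sum_sub_distrib, ← AddChar.map_add_eq_mul]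
    have h1 := hψ.sum_mul ((u⁻¹ : Fˣ) - (v⁻¹ : Fˣ) : F)
    have h2 := hψ.sum_mul (-(v⁻¹ : Fˣ) : F)
    simp only [neg_eq_zero, Units.ne_zero, if_false, neg_mul] at h2
    rw [h2, sub_zero]
    simp only [sub_eq_add_neg, add_mul, neg_mul] at h1
    rw [h1]
    simp only [← sub_eq_add_neg, sub_eq_zero, Units.val_inj, inv_inj]
    split_ifs <;> simp
  have hT : T.det ≠ 0 := by
    intro h
    have := congrArg Matrix.det hTT'
    rw [Matrix.det_mul, h, zero_mul, Matrix.det_smul, Matrix.det_one, mul_one] at this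
    exact pow_ne_zero _ (Nat.cast_ne_zero.2 Fintype.card_ne_zero) this.symm
  have hconj : T * (augmentationMatrix a).map (Int.castRingHom ℂ) = inducedMatrix ψ a 1 * T := by
    ext u y
    have hsum : ∀ z : F, ∑ x : F, (ψ ((u⁻¹ : Fˣ) * x) - 1) * ∑ w : Fˣ, (a (x - w * z) w : ℂ) =
        ∑ w : Fˣ, (∑ b, ψ ((u⁻¹ : Fˣ) * b) * a b w) * ψ ((u⁻¹ : Fˣ) * w * z) -
          ∑ w : Fˣ, ∑ b, (a b w : ℂ) := fun z => by
      simp only [Finset.mul_sum]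
      rw [Finset.sum_comm, ← Finset.sum_sub_distrib]
      refine Finset.sum_congr rfl fun w _ => ?_
      rw [← Equiv.sum_comp (Equiv.addRight (w * z : F)), Finset.sum_mul, ← Finset.sum_sub_distrib]
      refine Finset.sum_congr rfl fun b _ => ?_
      simp only [Equiv.coe_addRight, add_sub_cancel_right, mul_add, AddChar.map_add_eq_mul,
        mul_assoc]
      ring
    have hL : (T * (augmentationMatrix a).map (Int.castRingHom ℂ)) u y =
        ∑ x : F, (ψ ((u⁻¹ : Fˣ) * x) - 1) * ∑ w : Fˣ, (a (x - w * y) w : ℂ) -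
        ∑ x : F, (ψ ((u⁻¹ : Fˣ) * x) - 1) * ∑ w : Fˣ, (a (x - w * 0) w : ℂ) := by
      rw [← Finset.sum_sub_distrib]
      simp only [← mul_sub, ← Finset.sum_sub_distrib]
      have h := sum_units_eq_sub (fun x : F => (ψ ((u⁻¹ : Fˣ) * x) - 1) *
        ∑ w : Fˣ, ((a (x - w * y) w : ℂ) - a (x - w * 0) w))
      simp only [mul_zero, AddChar.map_zero_eq_one, sub_self, zero_mul, sub_zero] at h ⊢
      rw [← h]
      simp [Matrix.mul_apply, T, augmentationMatrix]
    rw [hL, hsum, hsum, sub_sub_sub_cancel_right, ← Finset.sum_sub_distrib, Matrix.mul_apply,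
      ← Equiv.sum_comp (Equiv.divLeft u)]
    refine Finset.sum_congr rfl fun v _ => ?_
    simp only [inducedMatrix, T, Matrix.of_apply, Equiv.divLeft_apply, one_mul, mul_zero,
      AddChar.map_zero_eq_one, mul_one, div_eq_mul_inv]
    have : ((u⁻¹ : Fˣ) : F) * ((u * v⁻¹ : Fˣ) : F) = (v⁻¹ : Fˣ) := by
      rw [← Units.val_mul, inv_mul_cancel_left]
    rw [this]
    ring
  have hdet := congrArg Matrix.det hconj
  rw [Matrix.det_mul, Matrix.det_mul, mul_comm, ← RingHom.mapMatrix_apply, ← RingHom.map_det]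
    at hdet
  exact (mul_right_cancel₀ hT hdet).symm

theorem exists_sum_det_inducedMatrix_eq {ψ : AddChar F ℂ} (hψ : ψ.IsPrimitive)
    (a : F → Fˣ → ℤ) :
    ∃ d : ℤ, ∑ r, (inducedMatrix ψ a r).det = (Fintype.card F : ℂ) * d := by
  let R : Matrix Fˣ Fˣ (AddMonoidAlgebra ℤ F) :=
    Matrix.of fun u v => ∑ b, AddMonoidAlgebra.single ((u⁻¹ : Fˣ) * b : F) (a b (u * v⁻¹))
  let e : F → AddMonoidAlgebra ℤ F →+* ℂ := fun r =>
    (AddMonoidAlgebra.lift ℤ ℂ F (ψ.mulShift r).toMonoidHom).toRingHom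
  have he : ∀ r x m, e r (AddMonoidAlgebra.single x m) = m * ψ (r * x) := fun r x m => by
    simp [e]
  have hR : ∀ r, (inducedMatrix ψ a r).det = e r R.det := fun r => by
    rw [RingHom.map_det]
    congr 1
    ext u v
    simp only [inducedMatrix, R, RingHom.mapMatrix_apply, Matrix.map_apply, Matrix.of_apply,
      map_sum, he]
    refine Finset.sum_congr rfl fun b _ => ?_
    rw [mul_comm, mul_assoc]
  have hd : ∀ d : AddMonoidAlgebra ℤ F, ∃ k : ℤ, ∑ r, e r d = (Fintype.card F : ℂ) * k := by
    intro d
    induction d using AddMonoidAlgebra.induction_linear with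
    | zero => exact ⟨0, by simp⟩
    | add f g hf hg =>
      obtain ⟨k, hk⟩ := hf
      obtain ⟨l, hl⟩ := hg
      exact ⟨k + l, by simp [Finset.sum_add_distrib, hk, hl, mul_add]⟩
    | single x m =>
      refine ⟨if x = 0 then m else 0, ?_⟩
      simp only [he, ← Finset.mul_sum, mul_comm _ x, hψ.sum_mul]
      split_ifs <;> simp [mul_comm]
  simp only [hR]
  exact hd R.det

theorem det_affineMatrix (a : F → Fˣ → ℤ) :
    (affineMatrix a).det =
      (scalingMatrix a).det * (augmentationMatrix a).det ^ (Fintype.card F - 1) := by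
  have hψ := AddChar.FiniteField.primitiveChar_to_Complex_isPrimitive F
  have h := det_affineMatrix_eq_prod hψ a
  rw [← Finset.mul_prod_erase _ _ (Finset.mem_univ 0), inducedMatrix_zero,
    ← RingHom.mapMatrix_apply, ← RingHom.map_det, Finset.prod_congr rfl
      (g := fun _ => ((augmentationMatrix a).det : ℂ)) (fun r hr => by
        rw [← det_inducedMatrix_one hψ]
        exact det_inducedMatrix_of_ne_zero _ a (Units.mk0 r (Finset.ne_of_mem_erase hr)))] at h
  rw [Finset.prod_const, Finset.card_erase_of_mem (Finset.mem_univ _), Finset.card_univ] at h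
  rw [eq_intCast] at h
  exact_mod_cast h

theorem det_augmentationMatrix_modEq (a : F → Fˣ → ℤ) :
    (augmentationMatrix a).det ≡ (scalingMatrix a).det [ZMOD Fintype.card F] := by
  have hψ := AddChar.FiniteField.primitiveChar_to_Complex_isPrimitive F
  obtain ⟨d, h⟩ := exists_sum_det_inducedMatrix_eq hψ a
  rw [← Finset.add_sum_erase _ _ (Finset.mem_univ 0), inducedMatrix_zero,
    ← RingHom.mapMatrix_apply, ← RingHom.map_det, Finset.sum_congr rfl
      (g := fun _ => ((augmentationMatrix a).det : ℂ)) (fun r hr => by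
        rw [← det_inducedMatrix_one hψ]
        exact det_inducedMatrix_of_ne_zero _ a (Units.mk0 r (Finset.ne_of_mem_erase hr)))] at h
  rw [Finset.sum_const, Finset.card_erase_of_mem (Finset.mem_univ _), Finset.card_univ,
    nsmul_eq_mul, Nat.cast_pred Fintype.card_pos] at h
  rw [eq_intCast] at h
  rw [Int.modEq_iff_dvd]
  refine ⟨d - (augmentationMatrix a).det, ?_⟩
  have h' : (scalingMatrix a).det + ((Fintype.card F : ℤ) - 1) * (augmentationMatrix a).det =
      (Fintype.card F : ℤ) * d := by
    rw [← @Int.cast_inj ℂ]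
    simp only [Int.cast_add, Int.cast_mul, Int.cast_sub, Int.cast_natCast, Int.cast_one]
    exact h
  linarith

/-- The pairs (image in the group ring of `Fˣ`, action on the augmentation ideal) realized by
elements of the group ring of `F ⋊ Fˣ`. -/
theorem exists_augmentationMatrix_eq (α : Fˣ → ℤ) (Y : Matrix Fˣ Fˣ ℤ) :
    ∃ a : F → Fˣ → ℤ, scalingMatrix a = Matrix.of (fun u v => α (u * v⁻¹)) ∧
      augmentationMatrix a =
        Matrix.of (fun u v => α (u * v⁻¹)) + (Fintype.card F : ℤ) • Y := by
  let W : F → F → ℤ := fun b n =>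
    if hn : n = 0 then 0 else
      if hb : b = 0 then -∑ x : Fˣ, Y x (Units.mk0 (-n) (neg_ne_zero.2 hn))
      else Y (Units.mk0 b hb) (Units.mk0 (-n) (neg_ne_zero.2 hn))
  have hWsum : ∀ n, ∑ b, W b n = 0 := fun n => by
    by_cases hn : n = 0
    · simp [W, hn]
    · have h := sum_units_eq_sub (fun b => W b n)
      have h0 : W 0 n = -∑ x : Fˣ, Y x (Units.mk0 (-n) (neg_ne_zero.2 hn)) := by simp [W, hn]
      rw [← sub_add_cancel (∑ b, W b n) (W 0 n), ← h, h0]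
      simp [W, hn]
  have hshift : ∀ c n, ∑ b, W (b - c) n = 0 := fun c n => by
    rw [← hWsum n]
    exact Equiv.sum_comp (Equiv.subRight c) (fun b => W b n)
  refine ⟨fun b u => (if b = 0 then α u else 0) + ∑ n, W (b - u * n) n, ?_, ?_⟩
  · ext u v
    simp only [scalingMatrix, Matrix.of_apply, Finset.sum_add_distrib]
    rw [Finset.sum_comm]
    simp [hshift]
  · have hM : ∀ (x : Fˣ) (y : F), ∑ u : Fˣ, ∑ n, W (x - u * y - u * n) n =
        Fintype.card F * W x (-y) - ∑ n, W x n := fun x y => by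
      rw [Finset.sum_comm]
      have h1 : ∀ n, ∑ u : Fˣ, W (x - u * y - u * n) n =
          (if n = -y then (Fintype.card F : ℤ) * W x (-y) else 0) - W x n := fun n => by
        have h := sum_units_eq_sub (fun u : F => W (x - u * y - u * n) n)
        rw [h]
        simp only [zero_mul, sub_zero]
        congr 1
        split_ifs with hn
        · subst hn
          simp
        · have hy : y + n ≠ 0 := fun h => hn (by linear_combination h)
          rw [← hWsum n]
          refine Fintype.sum_equiv ((Equiv.mulRight₀ (y + n) hy).trans (Equiv.subLeft (x : F))) _ _
            fun u => ?_
          simp only [Equiv.trans_apply, Equiv.mulRight₀_apply, Equiv.subLeft_apply]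
          congr 1
          ring
      simp [h1]
    ext x y
    have h0 := hM x 0
    simp only [mul_zero, sub_zero, neg_zero] at h0
    have hα : ∑ u : Fˣ, (if (x : F) - u * y = 0 then α u else 0) = α (x * y⁻¹) := by
      rw [Finset.sum_eq_single (x * y⁻¹)]
      · simp
      · intro u _ hu
        rw [if_neg]
        rw [sub_eq_zero, ← Units.val_mul, Units.val_inj]
        rintro rfl
        exact hu (by simp)
      · simp
    simp only [augmentationMatrix, Matrix.of_apply, Matrix.add_apply, Matrix.smul_apply,
      Finset.sum_sub_distrib, Finset.sum_add_distrib, hM, h0, hα]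
    have h1 : W x (-y) = Y x y := by simp [W]
    have h2 : W x 0 = 0 := by simp [W]
    simp only [h1, h2, Units.ne_zero, if_false, Finset.sum_const_zero]
    ring

end AffineDet

section CirculantDivisibility

open Matrix

theorem Matrix.det_fromBlocks_comm_pair {n R : Type*} [Fintype n] [DecidableEq n] [CommRing R]
    (X Y : Matrix n n R) : (fromBlocks X Y Y X).det = (X + Y).det * (X - Y).det := by
  have h : fromBlocks (1 : Matrix n n R) 1 0 1 * fromBlocks X Y Y X * fromBlocks 1 (-1) 0 1 =
      fromBlocks (X + Y) 0 Y (X - Y) := by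
    simp only [fromBlocks_multiply, Matrix.one_mul, Matrix.mul_one, Matrix.zero_mul,
      Matrix.mul_zero, Matrix.mul_neg, add_zero, zero_add]
    congr 1
    · abel
    · abel
  have hdet := congrArg Matrix.det h
  simpa [det_fromBlocks_zero₂₁, det_fromBlocks_zero₁₂] using hdet

/-- A determinant of a circulant matrix over `ZMod 2 × H` is a product of two determinants of
circulant matrices over `H` that are congruent modulo `2`. -/
theorem Matrix.exists_det_circulant_zmod_two_prod {H : Type*} [Fintype H] [DecidableEq H]
    [AddCommGroup H] (v : ZMod 2 × H → ℤ) :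
    ∃ w₁ w₂ : H → ℤ, (circulant v).det = (circulant w₁).det * (circulant w₂).det ∧
      (circulant w₁).det ≡ (circulant w₂).det [ZMOD 2] := by
  let X := circulant fun h => v (0, h)
  let Y := circulant fun h => v (1, h)
  let f : H ⊕ H → ZMod 2 × H := Sum.elim (fun h => (0, h)) fun h => (1, h)
  have hf : Function.Bijective f := by
    constructor
    · rintro (a | a) (b | b) h <;> simp_all [f]
    · rintro ⟨i, h⟩
      fin_cases i
      · exact ⟨Sum.inl h, rfl⟩
      · exact ⟨Sum.inr h, rfl⟩
  have hsub : (circulant v).submatrix (Equiv.ofBijective f hf) (Equiv.ofBijective f hf) =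
      fromBlocks X Y Y X := by
    have h2 : (0 - 1 : ZMod 2) = 1 := rfl
    ext (i | i) (j | j) <;> simp [f, X, Y, circulant_apply, h2]
  refine ⟨fun h => v (0, h) + v (1, h), fun h => v (0, h) - v (1, h), ?_, ?_⟩
  · rw [← det_submatrix_equiv_self (Equiv.ofBijective f hf), hsub, det_fromBlocks_comm_pair]
    rfl
  · refine (ZMod.intCast_eq_intCast_iff _ _ 2).1 ?_
    rw [← eq_intCast (Int.castRingHom (ZMod 2)),
      ← eq_intCast (Int.castRingHom (ZMod 2)), RingHom.map_det, RingHom.map_det]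
    congr 1
    ext i j
    simp [circulant_apply, ← CharTwo.sub_eq_add]

/-- In characteristic `p`, the `p`-th power of a circulant matrix over `ZMod p` is scalar. -/
theorem Matrix.circulant_pow_card {p : ℕ} [Fact p.Prime] (v : ZMod p → ZMod p) :
    circulant v ^ p = (∑ i, v i) • (1 : Matrix (ZMod p) (ZMod p) (ZMod p)) := by
  have hpow : ∀ (k : ZMod p) (m : ℕ), circulant (Pi.single k (1 : ZMod p)) ^ m =
      circulant (Pi.single (m • k) (1 : ZMod p)) := fun k m => by
    induction m with
    | zero => simp
    | succ m ih =>
      rw [pow_succ, ih, circulant_mul]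
      congr 1
      ext i
      rw [mulVec_single_one]
      simp [circulant_apply, Pi.single_apply, sub_eq_iff_eq_add, add_mul]
  have key : ∀ s : Finset (ZMod p), circulant (∑ k ∈ s, Pi.single k (v k)) ^ p =
      (∑ i ∈ s, v i) • (1 : Matrix (ZMod p) (ZMod p) (ZMod p)) := fun s => by
    induction s using Finset.induction_on with
    | empty => simp [(Fact.out : p.Prime).ne_zero]
    | insert k s hk ih =>
      have hsingle : (Pi.single k (v k) : ZMod p → ZMod p) = v k • Pi.single k 1 := by
        ext i
        simp [Pi.single_apply]
      have hcomm : Commute (circulant (Pi.single k (v k)))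
          (circulant (∑ i ∈ s, Pi.single i (v i))) := circulant_mul_comm _ _
      rw [Finset.sum_insert hk, Finset.sum_insert hk, circulant_add,
        add_pow_char_of_commute p hcomm, ih, hsingle, circulant_smul, smul_pow,
        ZMod.pow_card, hpow, nsmul_eq_mul, CharP.cast_eq_zero, zero_mul, circulant_single_one,
        add_smul]
  have := key Finset.univ
  rwa [Finset.univ_sum_single] at this

theorem Matrix.sq_dvd_det_of_dvd_sum {n : Type*} [Fintype n] [DecidableEq n] [Nonempty n]
    (M : Matrix n n ℤ) (S p : ℤ) (hrow : ∀ i, ∑ j, M i j = S) (hcol : ∀ j, ∑ i, M i j = S)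
    (hS : p ∣ S) (hn : p ∣ Fintype.card n) : p ^ 2 ∣ M.det := by
  obtain ⟨i₀⟩ := ‹Nonempty n›
  have h1 := det_updateRow_sum M i₀ fun _ => 1
  have hsum : ∑ k, (1 : ℤ) • M k = S • fun _ => 1 := by
    ext j
    rw [Finset.sum_apply]
    simpa using hcol j
  rw [hsum, det_updateRow_smul, one_smul] at h1
  rw [← h1, sq]
  refine mul_dvd_mul hS ?_
  have h2 := det_updateCol_sum (M.updateRow i₀ fun _ => 1) i₀ fun _ => 1
  rw [one_smul] at h2
  rw [← h2]
  have hdvd : ∀ k, p ∣ ∑ i, (1 : ℤ) • M.updateRow i₀ (fun _ => 1) k i := fun k => by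
    by_cases hk : k = i₀
    · subst hk
      simpa using hn
    · simpa [updateRow_ne hk, hrow] using hS
  choose w hw using hdvd
  have : (fun k => ∑ i, (1 : ℤ) • M.updateRow i₀ (fun _ => 1) k i) = p • w := funext hw
  rw [this, det_updateCol_smul]
  exact dvd_mul_right _ _

/-- Newman: if `p` divides the determinant of an integer circulant matrix of prime order `p`,
then so does `p ^ 2`. -/
theorem Matrix.sq_dvd_det_circulant {p : ℕ} [Fact p.Prime] (v : ZMod p → ℤ)
    (h : (p : ℤ) ∣ (circulant v).det) : (p : ℤ) ^ 2 ∣ (circulant v).det := by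
  refine sq_dvd_det_of_dvd_sum _ (∑ i, v i) p (fun i => ?_) (fun j => ?_) ?_ (by simp)
  · exact Equiv.sum_comp (Equiv.subLeft i) v
  · exact Equiv.sum_comp (Equiv.subRight j) v
  · have hpow := congrArg det (circulant_pow_card fun i => (v i : ZMod p))
    rw [det_pow, ZMod.pow_card, det_smul, det_one, mul_one, ZMod.card, ZMod.pow_card] at hpow
    have hmap : (circulant fun i => (v i : ZMod p)) =
        (Int.castRingHom (ZMod p)).mapMatrix (circulant v) := rfl
    rw [hmap, ← RingHom.map_det, eq_intCast, (ZMod.intCast_zmod_eq_zero_iff_dvd _ _).2 h] at hpow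
    rw [← ZMod.intCast_zmod_eq_zero_iff_dvd, Int.cast_sum, ← hpow]

theorem Matrix.det_circulant_dvd {p : ℕ} [Fact p.Prime] (v : ZMod 2 × ZMod p → ℤ) :
    (2 ∣ (circulant v).det → 4 ∣ (circulant v).det) ∧
      ((p : ℤ) ∣ (circulant v).det → (p : ℤ) ^ 2 ∣ (circulant v).det) := by
  obtain ⟨w₁, w₂, h, hmod⟩ := exists_det_circulant_zmod_two_prod v
  rw [h]
  constructor
  · intro h2
    rcases Int.prime_two.dvd_or_dvd h2 with h1 | h1
    · exact mul_dvd_mul h1 (hmod.dvd_iff.1 h1)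
    · exact mul_dvd_mul (hmod.dvd_iff.2 h1) h1
  · intro hp
    rcases (Nat.prime_iff_prime_int.1 Fact.out).dvd_or_dvd hp with h1 | h1
    · exact (sq_dvd_det_circulant _ h1).mul_right _
    · exact (sq_dvd_det_circulant _ h1).mul_left _

end CirculantDivisibility

section CirculantValues

open Matrix Polynomial

theorem ZMod.det_circulant {n : ℕ} [NeZero n] (v : ZMod n → ℤ) :
    ((circulant v).det : ℂ) = ∏ j, ∑ i, (v i : ℂ) * ZMod.stdAddChar (j * i) := by
  let ψ : AddChar (ZMod n) ℂ := ZMod.stdAddChar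
  have hψ : ψ.IsPrimitive := ZMod.isPrimitive_stdAddChar n
  let T : Matrix (ZMod n) (ZMod n) ℂ := Matrix.of fun i j => ψ (-(i * j))
  let T' : Matrix (ZMod n) (ZMod n) ℂ := Matrix.of fun i j => ψ (i * j)
  have hTT' : T * T' = (n : ℂ) • 1 := by
    ext i k
    simp only [T, T', mul_apply, of_apply, ← AddChar.map_add_eq_mul, Matrix.smul_apply, one_apply]
    have h := AddChar.sum_mulShift (k - i) hψ
    rw [ZMod.card, Nat.cast_ite] at h
    convert h using 1
    · exact Finset.sum_congr rfl fun j _ => congrArg ψ (by ring)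
    · simp [sub_eq_zero, eq_comm]
  have hT : T.det ≠ 0 := by
    intro h
    have := congrArg Matrix.det hTT'
    rw [Matrix.det_mul, h, zero_mul, Matrix.det_smul, Matrix.det_one, mul_one] at this
    exact pow_ne_zero _ (Nat.cast_ne_zero.2 (NeZero.ne n)) this.symm
  have hconj : (circulant v).map (Int.castRingHom ℂ) * T =
      T * diagonal fun j => ∑ i, (v i : ℂ) * ψ (j * i) := by
    ext i j
    rw [mul_diagonal, mul_apply, Finset.mul_sum, ← Equiv.sum_comp (Equiv.subLeft i)]
    refine Finset.sum_congr rfl fun k _ => ?_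
    simp only [T, map_apply, circulant_apply, of_apply, Equiv.subLeft_apply, sub_sub_cancel,
      eq_intCast]
    rw [mul_left_comm, ← AddChar.map_add_eq_mul]
    congr 2
    ring
  have hdet := congrArg Matrix.det hconj
  rw [det_mul, det_mul, mul_comm, det_diagonal, ← RingHom.mapMatrix_apply, ← RingHom.map_det]
    at hdet
  exact mul_left_cancel₀ hT hdet

/-- The circulant determinants of the coset of `P` modulo multiples of `1 + x + ⋯ + x ^ (n - 1)`. -/
theorem ZMod.exists_det_circulant_add_const {n : ℕ} [NeZero n] (P : ℤ[X]) (c : ℤ)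
    (hc : ∏ j ∈ Finset.univ.erase (0 : ZMod n), aeval (ZMod.stdAddChar j : ℂ) P = c) :
    ∃ v : ZMod n → ℤ, ∀ l : ℤ,
      (circulant fun i => v i + l).det = c * (P.eval 1 + n * l) := by
  have hP : ∃ v : ZMod n → ℤ, ∀ j : ZMod n,
      ∑ i, (v i : ℂ) * ZMod.stdAddChar (j * i) = aeval (ZMod.stdAddChar j : ℂ) P := by
    clear hc
    induction P using Polynomial.induction_on' with
    | add P Q hP hQ =>
      obtain ⟨v, hv⟩ := hP
      obtain ⟨w, hw⟩ := hQ
      exact ⟨v + w, fun j => by simp [add_mul, Finset.sum_add_distrib, hv, hw]⟩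
    | monomial k m =>
      refine ⟨Pi.single k m, fun j => ?_⟩
      rw [Finset.sum_eq_single (k : ZMod n) (fun i _ hi => by simp [hi]) (by simp), aeval_monomial,
        mul_comm j, ← nsmul_eq_mul, AddChar.map_nsmul_eq_pow]
      simp
  obtain ⟨v, hv⟩ := hP
  refine ⟨v, fun l => ?_⟩
  rw [← @Int.cast_inj ℂ, ZMod.det_circulant, ← Finset.mul_prod_erase _ _ (Finset.mem_univ 0)]
  have h0 : ∀ j : ZMod n, ∑ i, ((v i + l : ℤ) : ℂ) * ZMod.stdAddChar (j * i) =
      aeval (ZMod.stdAddChar j : ℂ) P + l * if j = 0 then (n : ℂ) else 0 := fun j => by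
    have h := AddChar.sum_mulShift j (ZMod.isPrimitive_stdAddChar n)
    rw [ZMod.card, Nat.cast_ite, Nat.cast_zero] at h
    simp only [Int.cast_add, add_mul, Finset.sum_add_distrib, hv, ← Finset.mul_sum, ← h]
    simp only [mul_comm j]
  rw [Finset.prod_congr rfl fun j hj => (h0 j).trans (by
    rw [if_neg (Finset.ne_of_mem_erase hj), mul_zero, add_zero]), hc, h0]
  have h1 : aeval (1 : ℂ) P = (P.eval 1 : ℤ) := by
    simp [aeval_def, eval₂_eq_eval_map]
  rw [AddChar.map_zero_eq_one, h1]
  push_cast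
  rw [if_pos rfl]
  ring

theorem ZMod.prod_erase_X_sub_stdAddChar {n : ℕ} [NeZero n] (y : ℂ) :
    ∏ j ∈ Finset.univ.erase (0 : ZMod n), (y - ZMod.stdAddChar j) = ∑ i ∈ Finset.range n, y ^ i := by
  let ψ : AddChar (ZMod n) ℂ := ZMod.stdAddChar
  have hroots : ∀ j : ZMod n, ψ j ^ n = 1 := fun j => by
    rw [← AddChar.map_nsmul_eq_pow]
    simp
  have hall : (∏ j : ZMod n, (X - C (ψ j)) : ℂ[X]) = X ^ n - 1 := by
    have hmonic : (X ^ n - 1 : ℂ[X]).Monic := by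
      simpa using monic_X_pow_sub_C (1 : ℂ) (NeZero.ne n)
    have hdeg : (X ^ n - 1 : ℂ[X]).natDegree = n := by
      simpa using natDegree_X_pow_sub_C (n := n) (r := (1 : ℂ))
    have hr : (Finset.univ.image ψ).val = (X ^ n - 1 : ℂ[X]).roots := by
      refine Multiset.eq_of_le_of_card_le ?_ ?_
      · rw [Finset.val_le_iff_val_subset]
        intro x hx
        simp only [Finset.mem_val, Finset.mem_image, Finset.mem_univ, true_and] at hx
        obtain ⟨j, rfl⟩ := hx
        rw [mem_roots hmonic.ne_zero]
        simp [hroots]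
      · refine (card_roots' _).trans ?_
        rw [hdeg, Finset.card_val, Finset.card_image_of_injective _ ZMod.injective_stdAddChar]
        simp
    have := prod_multiset_X_sub_C_of_monic_of_roots_card_eq hmonic (by
      rw [← hr, hdeg, Finset.card_val, Finset.card_image_of_injective _ ZMod.injective_stdAddChar]
      simp)
    rw [← this, ← hr]
    exact (Finset.prod_image (f := fun z => (X - C z : ℂ[X]))
      (ZMod.injective_stdAddChar.injOn)).symm
  have hpoly : (∏ j ∈ Finset.univ.erase (0 : ZMod n), (X - C (ψ j)) : ℂ[X]) =
      ∑ i ∈ Finset.range n, X ^ i := by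
    rw [← mul_left_inj' (X_sub_C_ne_zero (1 : ℂ))]
    rw [C_1, geom_sum_mul, ← hall, ← Finset.prod_erase_mul _ _ (Finset.mem_univ 0)]
    simp [ψ]
  have := congrArg (eval y) hpoly
  simpa [eval_prod, eval_finsetSum] using this

theorem ZMod.prod_erase_comp_unit {n : ℕ} [NeZero n] (u : (ZMod n)ˣ) (f : ZMod n → ℂ) :
    ∏ j ∈ Finset.univ.erase (0 : ZMod n), f (u * j) =
      ∏ j ∈ Finset.univ.erase (0 : ZMod n), f j := by
  refine Finset.prod_bij (fun j _ => u * j) ?_ ?_ ?_ ?_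
  · simp
  · simp
  · intro b hb
    exact ⟨(u⁻¹ : (ZMod n)ˣ) * b, by simpa using hb, by simp⟩
  · simp

theorem ZMod.prod_erase_geom_sum {n : ℕ} [NeZero n] {m : ℕ} (hm : m.Coprime n) :
    ∏ j ∈ Finset.univ.erase (0 : ZMod n), ∑ i ∈ Finset.range m, (ZMod.stdAddChar j : ℂ) ^ i = 1 := by
  have hne : ∏ j ∈ Finset.univ.erase (0 : ZMod n), ((ZMod.stdAddChar j : ℂ) - 1) ≠ 0 := by
    rw [Finset.prod_ne_zero_iff]
    intro j hj
    rw [sub_ne_zero, ← AddChar.map_zero_eq_one (ZMod.stdAddChar (N := n))]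
    exact ZMod.injective_stdAddChar.ne (Finset.ne_of_mem_erase hj)
  rw [← mul_left_inj' hne, one_mul, ← Finset.prod_mul_distrib]
  simp only [geom_sum_mul]
  simp only [← AddChar.map_nsmul_eq_pow, nsmul_eq_mul]
  have := ZMod.prod_erase_comp_unit (ZMod.unitOfCoprime m hm)
    fun j => (ZMod.stdAddChar j : ℂ) - 1
  simpa using this

theorem ZMod.exists_det_circulant_geom_sum {n : ℕ} [NeZero n] {m : ℕ} (hm : m.Coprime n) :
    ∃ v : ZMod n → ℤ, ∀ l : ℤ, (circulant fun i => v i + l).det = m + n * l := by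
  obtain ⟨v, hv⟩ := ZMod.exists_det_circulant_add_const (n := n) (∑ i ∈ Finset.range m, X ^ i) 1
    (by simpa using ZMod.prod_erase_geom_sum hm)
  exact ⟨v, fun l => by simpa [eval_finsetSum] using hv l⟩

theorem ZMod.exists_det_circulant_one_sub (n : ℕ) [NeZero n] :
    ∃ v : ZMod n → ℤ, ∀ l : ℤ, (circulant fun i => v i + l).det = n * (n * l) := by
  obtain ⟨v, hv⟩ := ZMod.exists_det_circulant_add_const (n := n) (1 - X) n
    (by simpa using ZMod.prod_erase_X_sub_stdAddChar (n := n) 1)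
  exact ⟨v, fun l => by simpa using hv l⟩

theorem ZMod.exists_det_circulant_one_add_sq {m : ℕ} (hm : m.Coprime 26) :
    ∃ v : ZMod 26 → ℤ, ∀ l : ℤ, (circulant fun i => v i + l).det = 2 * (2 * m + 26 * l) := by
  obtain ⟨v, hv⟩ := ZMod.exists_det_circulant_add_const (n := 26)
    ((1 + X ^ 2) * ∑ i ∈ Finset.range m, X ^ i) 2 (by
      have hfactor : ∀ j : ZMod 26, aeval (ZMod.stdAddChar j : ℂ)
          ((1 + X ^ 2) * ∑ i ∈ Finset.range m, X ^ i : ℤ[X]) =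
          (Complex.I - ZMod.stdAddChar j) * (-Complex.I - ZMod.stdAddChar j) *
            ∑ i ∈ Finset.range m, (ZMod.stdAddChar j : ℂ) ^ i := fun j => by
        simp only [map_mul, map_add, map_one, map_pow, aeval_X, map_sum]
        congr 1
        linear_combination Complex.I_sq
      simp only [hfactor, Finset.prod_mul_distrib]
      rw [ZMod.prod_erase_geom_sum hm, ZMod.prod_erase_X_sub_stdAddChar,
        ZMod.prod_erase_X_sub_stdAddChar]
      have hperiod : ∀ z : ℂ, z ^ 2 = -1 → ∑ i ∈ Finset.range 26, z ^ i = 1 + z := fun z hz => by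
        have hz1 : z - 1 ≠ 0 := fun h => by
          rw [sub_eq_zero.1 h] at hz
          norm_num at hz
        rw [← mul_left_inj' hz1, geom_sum_mul, show z ^ 26 = (z ^ 2) ^ 13 by ring, hz]
        linear_combination -hz
      rw [hperiod _ Complex.I_sq, hperiod (-Complex.I) (by simp)]
      push_cast
      linear_combination -Complex.I_sq)
  refine ⟨v, fun l => ?_⟩
  rw [hv]
  simp [eval_finsetSum]

theorem ZMod.exists_det_circulant_thirteen :
    ∃ v : ZMod 26 → ℤ, ∀ l : ℤ, (circulant fun i => v i + l).det = 13 * (13 + 26 * l) := by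
  let g : ℤ[X] := ∑ i ∈ Finset.range 6, X ^ (2 * i + 1) + ∑ i ∈ Finset.range 7, X ^ (2 * i + 12)
  obtain ⟨v, hv⟩ := ZMod.exists_det_circulant_add_const (n := 26) g 13 (by
    let ψ : AddChar (ZMod 26) ℂ := ZMod.stdAddChar
    let E : Finset (ZMod 26) := (Finset.univ.erase 0).erase 13
    have hE : ∀ f : ZMod 26 → ℂ, ∏ j ∈ Finset.univ.erase (0 : ZMod 26), f j =
        f 13 * ∏ j ∈ E, f j := fun f => (Finset.mul_prod_erase _ _ (by decide)).symm
    have hψ0 : ψ 0 = 1 := AddChar.map_zero_eq_one ψ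
    have hroot : ∀ j, ψ j ^ 26 = 1 := fun j => by
      rw [← AddChar.map_nsmul_eq_pow]
      rw [show 26 • j = 0 by revert j; decide, hψ0]
    have hψ13 : ψ 13 = -1 := by
      have h1 : ψ 13 ^ 2 = 1 := by
        rw [← AddChar.map_nsmul_eq_pow, ← hψ0]
        rfl
      have h2 : ψ 13 ≠ 1 := by
        rw [← hψ0]
        exact ZMod.injective_stdAddChar.ne (by decide)
      exact (eq_or_eq_neg_of_sq_eq_sq _ 1 (by rw [h1, one_pow])).resolve_left h2
    have hsub : ∏ j ∈ E, (ψ j - 1) = 13 := by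
      have h := ZMod.prod_erase_X_sub_stdAddChar (n := 26) 1
      have hneg : ∏ j ∈ E, (ψ j - 1) = ∏ j ∈ E, (1 - ψ j) := by
        rw [← mul_one (∏ j ∈ E, (1 - ψ j))]
        have : ∏ j ∈ E, (-1 : ℂ) = 1 := by
          rw [Finset.prod_const]
          have : E.card = 24 := by decide
          rw [this]
          norm_num
        rw [← this, ← Finset.prod_mul_distrib]
        exact Finset.prod_congr rfl fun j _ => by ring
      rw [hneg]
      rw [hE] at h
      change (1 - ψ 13) * ∏ j ∈ E, (1 - ψ j) = _ at h
      rw [hψ13] at h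
      simp only [one_pow, Finset.sum_const, Finset.card_range, nsmul_eq_mul] at h
      norm_num at h
      linear_combination h / 2
    have hadd : ∏ j ∈ E, (ψ j + 1) = 13 := by
      rw [← hsub]
      have : ∏ j ∈ E, (ψ j + 1) = ∏ j ∈ E, (-1) * (ψ (j + 13) - 1) :=
        Finset.prod_congr rfl fun j _ => by
          rw [AddChar.map_add_eq_mul, hψ13]
          ring
      rw [this, Finset.prod_mul_distrib]
      have h1 : ∏ j ∈ E, (-1 : ℂ) = 1 := by
        rw [Finset.prod_const]
        have : E.card = 24 := by decide
        rw [this]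
        norm_num
      rw [h1, one_mul]
      refine Finset.prod_bij (fun j _ => j + 13) ?_ ?_ ?_ ?_
      · decide
      · simp
      · decide
      · simp
    have hpow : ∏ j ∈ E, (ψ j ^ 12 - 1) = 169 := by
      have : ∏ j ∈ E, (ψ j ^ 12 - 1) = ∏ j ∈ E, (ψ j ^ 2 - 1) := by
        refine Finset.prod_bij (fun j _ => 19 * j) ?_ ?_ ?_ ?_
        · decide
        · decide
        · decide
        · intro j _
          rw [← AddChar.map_nsmul_eq_pow, ← AddChar.map_nsmul_eq_pow]
          congr 2
          revert j
          decide
      rw [this]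
      have h : ∀ j, ψ j ^ 2 - 1 = (ψ j - 1) * (ψ j + 1) := fun j => by ring
      simp only [h, Finset.prod_mul_distrib, hsub, hadd]
      norm_num
    have hg : ∀ z : ℂ, aeval z g = ∑ i ∈ Finset.range 6, z ^ (2 * i + 1) +
        ∑ i ∈ Finset.range 7, z ^ (2 * i + 12) := fun z => by simp [g]
    have hgE : ∏ j ∈ E, aeval (ψ j) g = 13 := by
      have h : ∏ j ∈ E, (ψ j + 1) * aeval (ψ j) g = ∏ j ∈ E, (ψ j ^ 12 - 1) := by
        refine Finset.prod_congr rfl fun j hj => ?_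
        have hj1 : ψ j - 1 ≠ 0 := by
          rw [sub_ne_zero, ← hψ0]
          exact ZMod.injective_stdAddChar.ne
            (Finset.ne_of_mem_erase (Finset.mem_of_mem_erase hj))
        refine mul_left_cancel₀ hj1 ?_
        rw [hg]
        simp only [Finset.sum_range_succ, Finset.sum_range_zero]
        linear_combination hroot j
      rw [Finset.prod_mul_distrib, hadd, hpow] at h
      linear_combination h / 13
    rw [hE, hgE]
    change aeval (ψ 13) g * _ = _
    rw [hψ13, hg]
    simp only [Finset.sum_range_succ, Finset.sum_range_zero]
    norm_num)
  refine ⟨v, fun l => ?_⟩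
  rw [hv]
  simp [g, eval_finsetSum]

end CirculantValues

section AffineTwentySeven

open Matrix

theorem exists_circulant_family {A : ℤ} (h2 : 2 ∣ A → 4 ∣ A) (h13 : 13 ∣ A → (13 : ℤ) ^ 2 ∣ A) :
    ∃ (v : ZMod 26 → ℤ) (c s l₀ : ℤ), IsCoprime c 27 ∧
      (∀ l : ℤ, (circulant fun i => v i + l).det = c * (s + 26 * l)) ∧ A = c * (s + 26 * l₀) := by
  have hcop : ∀ m : ℕ, m % 2 = 1 → m % 13 ≠ 0 → m.Coprime 26 := fun m hm2 hm13 => by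
    rw [show 26 = 2 * 13 from rfl]
    refine Nat.Coprime.mul_right ?_ ?_
    · exact Nat.coprime_two_right.2 (Nat.odd_iff.2 hm2)
    · exact ((Nat.Prime.coprime_iff_not_dvd (by norm_num)).2 (by omega)).symm
  by_cases hA13 : 13 ∣ A <;> by_cases hA2 : 2 ∣ A
  · obtain ⟨v, hv⟩ := ZMod.exists_det_circulant_one_sub 26
    obtain ⟨x, hx⟩ := h2 hA2
    obtain ⟨y, hy⟩ := h13 hA13
    refine ⟨v, 26, 0, x - 42 * y, ⟨-1, 1, by norm_num⟩, fun l => ?_,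
      by linear_combination 169 * hx - 168 * hy⟩
    rw [hv]
    push_cast
    ring
  · obtain ⟨v, hv⟩ := ZMod.exists_det_circulant_thirteen
    have := h13 hA13
    exact ⟨v, 13, 13, (A / 169 - 1) / 2, ⟨-2, 1, by norm_num⟩, hv, by omega⟩
  · have := h2 hA2
    obtain ⟨m, hm⟩ : ∃ m : ℕ, (m : ℤ) = A / 4 % 26 + (if 2 ∣ A / 4 then 13 else 0) :=
      Int.eq_ofNat_of_zero_le (by split_ifs <;> omega) |>.imp fun _ h => h.symm
    obtain ⟨v, hv⟩ := ZMod.exists_det_circulant_one_add_sq (m := m)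
      (hcop m (by split_ifs at hm <;> omega) (by split_ifs at hm <;> omega))
    refine ⟨v, 2, 2 * m, (A / 4 - m) / 13, ⟨-13, 1, by norm_num⟩, hv, ?_⟩
    split_ifs at hm <;> omega
  · obtain ⟨m, hm⟩ : ∃ m : ℕ, (m : ℤ) = A % 26 :=
      Int.eq_ofNat_of_zero_le (by omega) |>.imp fun _ h => h.symm
    obtain ⟨v, hv⟩ := ZMod.exists_det_circulant_geom_sum (n := 26) (m := m)
      (hcop m (by omega) (by omega))
    refine ⟨v, 1, m, (A - m) / 26, isCoprime_one_left, fun l => ?_, by omega⟩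
    rw [hv]
    push_cast
    ring

theorem exists_circulant_add_smul_det_eq {A B : ℤ} (h2 : 2 ∣ A → 4 ∣ A)
    (h13 : 13 ∣ A → (13 : ℤ) ^ 2 ∣ A) (hB : B ≡ A [ZMOD 27]) :
    ∃ (v : ZMod 26 → ℤ) (Y : Matrix (ZMod 26) (ZMod 26) ℤ),
      (circulant v).det = A ∧ (circulant v + (27 : ℤ) • Y).det = B := by
  obtain ⟨v, c, s, l₀, ⟨c', t, hc⟩, hv, rfl⟩ := exists_circulant_family h2 h13
  let X := circulant fun i => v i + (s - c')
  have hX : (X.det : ZMod 27) = 1 := by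
    rw [hv, ← Int.cast_one]
    refine (ZMod.intCast_eq_intCast_iff _ _ 27).2 (
      (Int.modEq_iff_dvd.2 ⟨c * s - c * c' - t, ?_⟩).symm)
    push_cast
    linear_combination hc
  have hX0 : X.det ≠ 0 := by
    intro h
    rw [h] at hX
    exact absurd hX (by decide)
  have hshift : X + Matrix.of (fun _ _ => l₀ - (s - c')) = circulant fun i => v i + l₀ := by
    ext i j
    simp only [X, Matrix.add_apply, circulant_apply, Matrix.of_apply]
    ring
  obtain ⟨Y, hY⟩ := Matrix.exists_det_eq_of_modEq_add_const (N := 27) X hX0 hX (l₀ - (s - c')) B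
    (by rwa [hshift, hv])
  rw [hshift] at hY
  exact ⟨_, Y, hv l₀, hY⟩

variable {F : Type*} [Field F] [Fintype F] [DecidableEq F]

theorem exists_affineMatrix_det_eq_iff (hF : Fintype.card F = 27) (D : ℤ) :
    (∃ a : F → Fˣ → ℤ, (affineMatrix a).det = D) ↔
      ∃ A B : ℤ, ((2 ∣ A → 4 ∣ A) ∧ (13 ∣ A → (13 : ℤ) ^ 2 ∣ A)) ∧
        B ≡ A [ZMOD 27] ∧ D = A * B ^ 26 := by
  have hcard : Nat.card Fˣ = 26 := by
    rw [Nat.card_eq_fintype_card, Fintype.card_units, hF]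
  let e : Multiplicative (ZMod 26) ≃* Fˣ := hcard ▸ zmodCyclicMulEquiv inferInstance
  constructor
  · rintro ⟨a, rfl⟩
    refine ⟨(scalingMatrix a).det, (augmentationMatrix a).det, ?_, ?_, ?_⟩
    · have : Fact (Nat.Prime 13) := ⟨by norm_num⟩
      let e' : ZMod 26 ≃+* ZMod 2 × ZMod 13 :=
        ZMod.chineseRemainder (m := 2) (n := 13) (by norm_num)
      let f : ZMod 2 × ZMod 13 ≃ Fˣ :=
        e'.toEquiv.symm.trans (Multiplicative.ofAdd.trans e.toEquiv)
      have hf : (scalingMatrix a).submatrix f f = circulant fun i => ∑ b, a b (f i) := by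
        ext i j
        have : f (i - j) = f i * (f j)⁻¹ := by
          simp [f, ofAdd_sub, div_eq_mul_inv]
        simp [scalingMatrix, circulant_apply, this]
      rw [← det_submatrix_equiv_self f, hf]
      exact_mod_cast det_circulant_dvd (p := 13) fun i => ∑ b, a b (f i)
    · have := det_augmentationMatrix_modEq a
      rwa [hF] at this
    · rw [det_affineMatrix, hF]
  · rintro ⟨A, B, ⟨h2, h13⟩, hB, rfl⟩
    obtain ⟨v, Y, hA, hY⟩ := exists_circulant_add_smul_det_eq h2 h13 hB
    let f : ZMod 26 ≃ Fˣ := Multiplicative.ofAdd.trans e.toEquiv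
    have hf : (Matrix.of fun u w : Fˣ => v (f.symm (u * w⁻¹))).submatrix f f = circulant v := by
      ext i j
      have : f i * (f j)⁻¹ = f (i - j) := by
        simp [f, ofAdd_sub, div_eq_mul_inv]
      simp [circulant_apply, this]
    obtain ⟨a, ha, ha'⟩ := exists_augmentationMatrix_eq (fun u => v (f.symm u))
      (Y.submatrix f.symm f.symm)
    refine ⟨a, ?_⟩
    have h1 : (scalingMatrix a).det = A := by
      rw [ha, ← det_submatrix_equiv_self f, hf, hA]
    have h2 : (augmentationMatrix a).det = B := by
      rw [ha', ← det_submatrix_equiv_self f, submatrix_add, Pi.add_apply, Pi.add_apply, hf, hF, ← hY]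
      congr 2
      ext i j
      simp only [submatrix_apply, Matrix.smul_apply, Equiv.symm_apply_apply]
      rfl
    rw [det_affineMatrix, hF, h1, h2]

end AffineTwentySeven

theorem groupDet_GA1_eq (p k : ℕ) [Fact p.Prime] [Fintype (GaloisField p k)]
    [DecidableEq (GaloisField p k)] (a : GA1 p k → ℤ) :
    groupDet (GA1 p k) a =
      (affineMatrix fun b u => a ⟨Multiplicative.ofAdd b, u⟩).det := by
  let e : GA1 p k ≃ (GaloisField p k)ˣ × GaloisField p k :=
    { toFun := fun g => (g.right, g.left.toAdd)
      invFun := fun x => ⟨Multiplicative.ofAdd x.2, x.1⟩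
      left_inv := fun _ => rfl
      right_inv := fun _ => rfl }
  let _ : Fintype (GA1 p k) := Fintype.ofFinite _
  let _ : DecidableEq (GA1 p k) := Classical.decEq _
  rw [← Matrix.det_submatrix_equiv_self e]
  change Matrix.det _ = _
  congr 1
  ext g h
  simp only [Matrix.of_apply, Matrix.submatrix_apply, affineMatrix]
  congr 1
  refine SemidirectProduct.ext ?_ rfl
  rw [SemidirectProduct.mul_left, SemidirectProduct.inv_left]
  apply Multiplicative.toAdd.injective
  simp [GAaction, Units.smul_def, sub_eq_add_neg, mul_assoc]
  rfl

/-- The integer group determinants of `GA(1,27)` are exactly the `A * B^26` with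
`2 ∣ A → 4 ∣ A`, `13 ∣ A → 13² ∣ A`, and `B ≡ A (mod 27)`. -/
theorem stmt5 (D : ℤ) :
    IsIntGroupDet (GA1 3 3) D ↔
      ∃ A B : ℤ, ((2 ∣ A → 4 ∣ A) ∧ (13 ∣ A → (13 : ℤ) ^ 2 ∣ A)) ∧
        B ≡ A [ZMOD 27] ∧ D = A * B ^ 26 := by
  classical
  let _ : Fintype (GaloisField 3 3) := Fintype.ofFinite _
  have hF : Fintype.card (GaloisField 3 3) = 27 := by
    rw [← Nat.card_eq_fintype_card, GaloisField.card 3 3 (by norm_num)]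
    norm_num
  rw [← exists_affineMatrix_det_eq_iff hF D]
  constructor
  · rintro ⟨a, rfl⟩
    exact ⟨_, (groupDet_GA1_eq 3 3 a).symm⟩
  · rintro ⟨a, rfl⟩
    exact ⟨fun g => a g.left.toAdd g.right, groupDet_GA1_eq 3 3 _⟩
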